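/- arXiv:2502.09942 — 2 statements merged into one kernel-verified Lean document; each statement's English description precedes it below -/
import Mathlib

section
/- Let n ≥ 1, p > 1, q = p/(p-1), and let f and g be nonnegative measurable functions on ℝⁿ with f ∈ L^p(ℝⁿ) and g ∈ L^q(ℝⁿ). Then, with |·| the Euclidean norm, ∫_{ℝⁿ}∫_{ℝⁿ} (f(x) g(y)/(|x| + |y|)) |x|^{(1−n)/q} |y|^{(1−n)/p} dx dy ≤ (nπ/sin(π/p)) · (π^{n/2}/Γ(n/2 + 1)) · (∫_{ℝⁿ} f(x)^p dx)^{1/p} · (∫_{ℝⁿ} g(y)^q dy)^{1/q}. -/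
open MeasureTheory Set ENNReal

theorem lintegral_rpow_mul_exp_neg_mul_Ioi {a r : ℝ} (ha : 0 < a) (hr : 0 < r) :
    ∫⁻ t in Ioi (0 : ℝ), ENNReal.ofReal (t ^ (a - 1) * Real.exp (-(r * t))) =
      ENNReal.ofReal (r ^ (-a) * Real.Gamma a) := by
  have hint := Real.integral_rpow_mul_exp_neg_mul_Ioi ha hr
  have hpos : 0 < (1 / r) ^ a * Real.Gamma a :=
    mul_pos (Real.rpow_pos_of_pos (by positivity) _) (Real.Gamma_pos_of_pos ha)
  rw [← ofReal_integral_eq_lintegral_ofReal, hint, one_div, Real.inv_rpow hr.le,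
    Real.rpow_neg hr.le]
  · exact not_imp_comm.1 integral_undef (hint ▸ hpos.ne')
  · filter_upwards [ae_restrict_mem measurableSet_Ioi] with t (ht : 0 < t)
    have := Real.rpow_pos_of_pos ht (a - 1)
    simp only [Pi.zero_apply]
    positivity

theorem lintegral_rpow_neg_div_add_Ioi {c r : ℝ} (hc₀ : 0 < c) (hc₁ : c < 1) (hr : 0 < r) :
    ∫⁻ t in Ioi (0 : ℝ), ENNReal.ofReal (t ^ (-c) / (t + r)) =
      ENNReal.ofReal (r ^ (-c) * (Real.pi / Real.sin (Real.pi * c))) := by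
  have hsc : 0 < 1 - c := sub_pos.2 hc₁
  calc
    _ = ∫⁻ t in Ioi (0 : ℝ), ∫⁻ s in Ioi (0 : ℝ),
          ENNReal.ofReal (t ^ (-c) * Real.exp (-((t + r) * s))) := by
      refine setLIntegral_congr_fun measurableSet_Ioi fun t (ht : 0 < t) => ?_
      have h := lintegral_rpow_mul_exp_neg_mul_Ioi one_pos (add_pos ht hr)
      simp only [sub_self, Real.rpow_zero, one_mul, Real.Gamma_one, mul_one,
        Real.rpow_neg_one] at h
      simp_rw [ENNReal.ofReal_mul (Real.rpow_nonneg ht.le (-c))]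
      rw [lintegral_const_mul _ (by fun_prop), h, div_eq_mul_inv,
        ENNReal.ofReal_mul (Real.rpow_nonneg ht.le (-c))]
    _ = ∫⁻ s in Ioi (0 : ℝ), ∫⁻ t in Ioi (0 : ℝ),
          ENNReal.ofReal (t ^ (-c) * Real.exp (-((t + r) * s))) :=
      lintegral_lintegral_swap (by fun_prop)
    _ = ∫⁻ s in Ioi (0 : ℝ), ENNReal.ofReal (Real.Gamma (1 - c)) *
          ENNReal.ofReal (s ^ (c - 1) * Real.exp (-(r * s))) := by
      refine setLIntegral_congr_fun measurableSet_Ioi fun s (hs : 0 < s) => ?_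
      have h := lintegral_rpow_mul_exp_neg_mul_Ioi hsc hs
      have hsplit (t : ℝ) : ENNReal.ofReal (t ^ (-c) * Real.exp (-((t + r) * s))) =
          ENNReal.ofReal (Real.exp (-(r * s))) *
            ENNReal.ofReal (t ^ (1 - c - 1) * Real.exp (-(s * t))) := by
        rw [← ENNReal.ofReal_mul (Real.exp_pos _).le, mul_left_comm, ← Real.exp_add]
        ring_nf
      simp_rw [hsplit]
      rw [lintegral_const_mul _ (by fun_prop), h, ← ENNReal.ofReal_mul (Real.exp_pos _).le,
        ← ENNReal.ofReal_mul (Real.Gamma_pos_of_pos hsc).le]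
      ring_nf
    _ = _ := by
      rw [lintegral_const_mul _ (by fun_prop), lintegral_rpow_mul_exp_neg_mul_Ioi hc₀ hr,
        ← ENNReal.ofReal_mul (Real.Gamma_pos_of_pos hsc).le,
        ← Real.Gamma_mul_Gamma_one_sub]
      ring_nf

theorem lintegral_fun_norm_addHaar {E : Type*} [NormedAddCommGroup E] [NormedSpace ℝ E]
    [Nontrivial E] [FiniteDimensional ℝ E] [MeasurableSpace E] [BorelSpace E]
    (μ : Measure E) [μ.IsAddHaarMeasure] {f : ℝ → ℝ≥0∞} (hf : Measurable f) :
    ∫⁻ x, f ‖x‖ ∂μ = Module.finrank ℝ E * μ (Metric.ball 0 1) *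
      ∫⁻ y in Ioi (0 : ℝ), ENNReal.ofReal (y ^ (Module.finrank ℝ E - 1)) * f y :=
  calc
    ∫⁻ x, f ‖x‖ ∂μ = ∫⁻ x : ({(0)}ᶜ : Set E), f ‖x.1‖ ∂(μ.comap (↑)) := by
      rw [lintegral_subtype_comap (measurableSet_singleton _).compl fun x ↦ f ‖x‖,
        restrict_compl_singleton]
    _ = ∫⁻ x, f x.2 ∂μ.toSphere.prod (.volumeIoiPow (Module.finrank ℝ E - 1)) := by
      simpa using μ.measurePreserving_homeomorphUnitSphereProd.lintegral_comp_emb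
        (Homeomorph.measurableEmbedding _) (f ∘ Subtype.val ∘ Prod.snd)
    _ = μ.toSphere univ * ∫⁻ x : Ioi (0 : ℝ), f x ∂.volumeIoiPow (Module.finrank ℝ E - 1) := by
      rw [lintegral_prod _ (by fun_prop)]
      simp only [lintegral_const]
      rw [mul_comm]
    _ = _ := by
      rw [Measure.volumeIoiPow, lintegral_withDensity_eq_lintegral_mul _ (by fun_prop)
        (by fun_prop), μ.toSphere_apply_univ]
      simp only [Pi.mul_apply]
      rw [lintegral_subtype_comap measurableSet_Ioi
        fun a ↦ ENNReal.ofReal (a ^ (Module.finrank ℝ E - 1)) * f a]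

/-- The Schur test weight for the Hardy–Hilbert kernel on `ℝⁿ`, as a function of the norms. -/
noncomputable def hilbertWeight (n c a b : ℝ) : ℝ :=
  a ^ c * b ^ (-c) * b ^ (1 - n) / (a + b)

@[fun_prop]
theorem measurable_hilbertWeight {α : Type*} [MeasurableSpace α] {n c : ℝ} {u v : α → ℝ}
    (hu : Measurable u) (hv : Measurable v) :
    Measurable fun x => hilbertWeight n c (u x) (v x) := by
  unfold hilbertWeight
  fun_prop

theorem hilbertWeight_nonneg {n c a b : ℝ} (ha : 0 ≤ a) (hb : 0 ≤ b) :
    0 ≤ hilbertWeight n c a b := by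
  unfold hilbertWeight
  positivity

theorem hilbertWeight_rpow_mul_rpow {n p q a b : ℝ} (h : p.HolderConjugate q)
    (ha : 0 < a) (hb : 0 < b) :
    hilbertWeight n (1 / q) a b ^ (1 / p) * hilbertWeight n (1 / p) b a ^ (1 / q) =
      (a + b)⁻¹ * (a ^ ((1 - n) / q) * b ^ ((1 - n) / p)) := by
  have hab : 0 < a + b := add_pos ha hb
  have hpq : 1 / p + 1 / q = 1 := by simpa using h.inv_add_inv_eq_one
  have key {c s x y : ℝ} (hx : 0 < x) (hy : 0 < y) : hilbertWeight n c x y ^ s =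
      Real.exp ((c * Real.log x - c * Real.log y + (1 - n) * Real.log y
        - Real.log (x + y)) * s) := by
    have hxy : 0 < x + y := add_pos hx hy
    rw [Real.exp_mul]
    congr 1
    rw [Real.exp_sub, Real.exp_log hxy, hilbertWeight, Real.rpow_def_of_pos hx,
      Real.rpow_def_of_pos hy, Real.rpow_def_of_pos hy, ← Real.exp_add, ← Real.exp_add]
    ring_nf
  rw [key ha hb, key hb ha, add_comm b a, Real.rpow_def_of_pos ha, Real.rpow_def_of_pos hb,
    ← Real.exp_log hab, ← Real.exp_neg, ← Real.exp_add, ← Real.exp_add, ← Real.exp_add,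
    Real.log_exp]
  congr 1
  linear_combination (-Real.log (a + b)) * hpq

theorem lintegral_hilbertWeight {n : ℕ} (hn : 1 ≤ n) {c a : ℝ} (hc₀ : 0 < c) (hc₁ : c < 1)
    (ha : 0 < a) :
    ∫⁻ y : EuclideanSpace ℝ (Fin n), ENNReal.ofReal (hilbertWeight n c a ‖y‖) =
      ENNReal.ofReal ((n * Real.pi / Real.sin (Real.pi * c)) *
          (Real.pi ^ ((n : ℝ) / 2) / Real.Gamma ((n : ℝ) / 2 + 1))) := by
  have : Nonempty (Fin n) := ⟨⟨0, hn⟩⟩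
  have hac := Real.rpow_pos_of_pos ha c
  have hΓ : 0 < Real.Gamma ((n : ℝ) / 2 + 1) := Real.Gamma_pos_of_pos (by positivity)
  have hradial : ∫⁻ t in Ioi (0 : ℝ), ENNReal.ofReal (t ^ (n - 1)) *
      ENNReal.ofReal (hilbertWeight n c a t) =
      ENNReal.ofReal (Real.pi / Real.sin (Real.pi * c)) := by
    calc
      _ = ∫⁻ t in Ioi (0 : ℝ), ENNReal.ofReal (a ^ c) * ENNReal.ofReal (t ^ (-c) / (t + a)) := by
        refine setLIntegral_congr_fun measurableSet_Ioi fun t (ht : 0 < t) => ?_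
        have hpow : t ^ (n - 1) * t ^ (1 - (n : ℝ)) = 1 := by
          rw [← Real.rpow_natCast, ← Real.rpow_add ht, Nat.cast_sub hn]
          simp
        rw [← ENNReal.ofReal_mul (by positivity), ← ENNReal.ofReal_mul hac.le, hilbertWeight,
          add_comm a t]
        congr 1
        linear_combination (a ^ c * t ^ (-c) / (t + a)) * hpow
      _ = _ := by
        rw [lintegral_const_mul _ (by fun_prop), lintegral_rpow_neg_div_add_Ioi hc₀ hc₁ ha,
          ← ENNReal.ofReal_mul hac.le, ← mul_assoc, ← Real.rpow_add ha]
        simp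
  rw [lintegral_fun_norm_addHaar volume (f := fun t => ENNReal.ofReal (hilbertWeight n c a t))
    (by fun_prop), finrank_euclideanSpace_fin, hradial, EuclideanSpace.volume_ball,
    Fintype.card_fin, ENNReal.ofReal_one, one_pow, one_mul, ← ENNReal.ofReal_natCast n,
    ← ENNReal.ofReal_mul (by positivity), ← ENNReal.ofReal_mul (by positivity),
    Real.sqrt_eq_rpow, ← Real.rpow_mul_natCast Real.pi_pos.le]
  ring_nf

theorem lintegral_lintegral_mul_hilbertWeight {n : ℕ} (hn : 1 ≤ n) {c : ℝ} (hc₀ : 0 < c)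
    (hc₁ : c < 1) {h : EuclideanSpace ℝ (Fin n) → ℝ≥0∞} (hh : Measurable h) :
    ∫⁻ x, ∫⁻ y : EuclideanSpace ℝ (Fin n), h x * ENNReal.ofReal (hilbertWeight n c ‖x‖ ‖y‖) =
      ENNReal.ofReal ((n * Real.pi / Real.sin (Real.pi * c)) *
          (Real.pi ^ ((n : ℝ) / 2) / Real.Gamma ((n : ℝ) / 2 + 1))) * ∫⁻ x, h x := by
  have : Nonempty (Fin n) := ⟨⟨0, hn⟩⟩
  rw [← lintegral_const_mul _ hh]
  refine lintegral_congr_ae ?_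
  filter_upwards [Measure.ae_ne volume 0] with x hx
  rw [lintegral_const_mul _ (by fun_prop),
    lintegral_hilbertWeight hn hc₀ hc₁ (norm_pos_iff.2 hx), mul_comm]

/-- Hardy–Hilbert type inequality on `ℝⁿ` with the Euclidean norm:
`∫∫ (f(x)g(y)/(|x|+|y|)) |x|^{(1−n)/q} |y|^{(1−n)/p} dx dy
  ≤ (nπ/sin(π/p)) (π^{n/2}/Γ(n/2+1)) ‖f‖_p ‖g‖_q`. -/
theorem stmt_11 (n : ℕ) (hn : 1 ≤ n) (p q : ℝ) (hp : 1 < p) (hq : q = p / (p - 1))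
    (f g : EuclideanSpace ℝ (Fin n) → ℝ≥0∞) (hf : Measurable f) (hg : Measurable g)
    (hfp : ∫⁻ x, f x ^ p < ⊤) (hgq : ∫⁻ y, g y ^ q < ⊤) :
    ∫⁻ y, ∫⁻ x,
        f x * g y / ENNReal.ofReal (‖x‖ + ‖y‖) *
          ENNReal.ofReal (‖x‖ ^ ((1 - (n : ℝ)) / q) * ‖y‖ ^ ((1 - (n : ℝ)) / p)) ≤
      ENNReal.ofReal ((n * Real.pi / Real.sin (Real.pi / p)) *
          (Real.pi ^ ((n : ℝ) / 2) / Real.Gamma ((n : ℝ) / 2 + 1))) *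
        (∫⁻ x, f x ^ p) ^ (1 / p) * (∫⁻ y, g y ^ q) ^ (1 / q) := by
  have : Nonempty (Fin n) := ⟨⟨0, hn⟩⟩
  have hpq : p.HolderConjugate q := (Real.holderConjugate_iff_eq_conjExponent hp).2 hq
  have hp₀ := hpq.pos
  have hq₀ := hpq.symm.pos
  have hsum : 1 / p + 1 / q = 1 := by simpa using hpq.inv_add_inv_eq_one
  have hp₁ : 1 / p < 1 := by linarith [one_div_pos.2 hq₀]
  have hq₁ : 1 / q < 1 := by linarith [one_div_pos.2 hp₀]
  have hsin : Real.sin (Real.pi * (1 / q)) = Real.sin (Real.pi * (1 / p)) := by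
    rw [← Real.sin_pi_sub]
    congr 1
    linear_combination (-Real.pi) * hsum
  set C := ENNReal.ofReal ((n * Real.pi / Real.sin (Real.pi / p)) *
          (Real.pi ^ ((n : ℝ) / 2) / Real.Gamma ((n : ℝ) / 2 + 1))) with hC
  let E := EuclideanSpace ℝ (Fin n)
  let F : E × E → ℝ≥0∞ := fun z =>
    f z.2 * ENNReal.ofReal (hilbertWeight n (1 / q) ‖z.2‖ ‖z.1‖) ^ (1 / p)
  let G : E × E → ℝ≥0∞ := fun z =>
    g z.1 * ENNReal.ofReal (hilbertWeight n (1 / p) ‖z.1‖ ‖z.2‖) ^ (1 / q)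
  have hF : Measurable F := by fun_prop
  have hG : Measurable G := by fun_prop
  have hFp : ∫⁻ z, F z ^ p ∂volume.prod volume = C * ∫⁻ x, f x ^ p := by
    have hpow (z : E × E) :
        F z ^ p = f z.2 ^ p * ENNReal.ofReal (hilbertWeight n (1 / q) ‖z.2‖ ‖z.1‖) := by
      rw [ENNReal.mul_rpow_of_nonneg _ _ hp₀.le, ← ENNReal.rpow_mul, one_div_mul_cancel hp₀.ne',
        ENNReal.rpow_one]
    simp_rw [hpow]
    rw [lintegral_prod_symm' _ (by fun_prop)]
    simp only
    rw [lintegral_lintegral_mul_hilbertWeight hn (one_div_pos.2 hq₀) hq₁ (by fun_prop), hsin,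
      mul_one_div]
  have hGq : ∫⁻ z, G z ^ q ∂volume.prod volume = C * ∫⁻ y, g y ^ q := by
    have hpow (z : E × E) :
        G z ^ q = g z.1 ^ q * ENNReal.ofReal (hilbertWeight n (1 / p) ‖z.1‖ ‖z.2‖) := by
      rw [ENNReal.mul_rpow_of_nonneg _ _ hq₀.le, ← ENNReal.rpow_mul, one_div_mul_cancel hq₀.ne',
        ENNReal.rpow_one]
    simp_rw [hpow]
    rw [lintegral_prod _ (by fun_prop)]
    simp only
    rw [lintegral_lintegral_mul_hilbertWeight hn (one_div_pos.2 hp₀) hp₁ (by fun_prop),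
      mul_one_div]
  calc
    _ = ∫⁻ y, ∫⁻ x, F (y, x) * G (y, x) := by
      refine lintegral_congr_ae ?_
      filter_upwards [Measure.ae_ne volume 0] with y hy
      refine lintegral_congr_ae ?_
      filter_upwards [Measure.ae_ne volume 0] with x hx
      have hx' := norm_pos_iff.2 hx
      have hy' := norm_pos_iff.2 hy
      have hw := hilbertWeight_rpow_mul_rpow (n := n) hpq hx' hy'
      have hxy : 0 < ‖x‖ + ‖y‖ := add_pos hx' hy'
      simp only [F, G]
      rw [mul_mul_mul_comm, ENNReal.ofReal_rpow_of_nonneg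
        (hilbertWeight_nonneg hx'.le hy'.le) (one_div_pos.2 hp₀).le,
        ENNReal.ofReal_rpow_of_nonneg (hilbertWeight_nonneg hy'.le hx'.le) (one_div_pos.2 hq₀).le,
        ← ENNReal.ofReal_mul (Real.rpow_nonneg (hilbertWeight_nonneg hx'.le hy'.le) _), hw,
        ENNReal.ofReal_mul (inv_pos.2 hxy).le, ENNReal.ofReal_inv_of_pos hxy, div_eq_mul_inv,
        mul_assoc _ _ (ENNReal.ofReal _)]
    _ = ∫⁻ z, (F * G) z ∂volume.prod volume := (lintegral_prod _ (hF.mul hG).aemeasurable).symm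
    _ ≤ (∫⁻ z, F z ^ p ∂volume.prod volume) ^ (1 / p) *
          (∫⁻ z, G z ^ q ∂volume.prod volume) ^ (1 / q) :=
      ENNReal.lintegral_mul_le_Lp_mul_Lq _ hpq hF.aemeasurable hG.aemeasurable
    _ = C ^ (1 / p + 1 / q) * (∫⁻ x, f x ^ p) ^ (1 / p) * (∫⁻ y, g y ^ q) ^ (1 / q) := by
      rw [hFp, hGq, ENNReal.mul_rpow_of_nonneg _ _ (one_div_pos.2 hp₀).le,
        ENNReal.mul_rpow_of_nonneg _ _ (one_div_pos.2 hq₀).le,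
        ENNReal.rpow_add_of_nonneg _ _ (one_div_pos.2 hp₀).le (one_div_pos.2 hq₀).le]
      ring
    _ = _ := by rw [hsum, ENNReal.rpow_one]
end

section
/- Let n ≥ 1, p > 1, k > 1, 1/p + 1/q = 1, 1/k + 1/m = 1, and λ > 0. If f and g are nonnegative measurable functions on ℝⁿ with 0 < ∫_{ℝⁿ} |x|^{p(1−λ/k)−1} f(x)^p dx < ∞ and 0 < ∫_{ℝⁿ} |y|^{q(1−λ/m)−1} g(y)^q dy < ∞, then ∫_{ℝⁿ}∫_{ℝⁿ} (f(x) g(y)/(|x|^λ + |y|^λ)) |x|^{(1−n)/q} |y|^{(1−n)/p} dx dy ≤ (nπ/(λ sin(π/m))) · (π^{n/2}/Γ(n/2 + 1)) · (∫_{ℝⁿ} |x|^{p(1−λ/k)−1} f(x)^p dx)^{1/p} · (∫_{ℝⁿ} |y|^{q(1−λ/m)−1} g(y)^q dy)^{1/q}. -/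
open MeasureTheory Set ENNReal

/-- The Gamma-type integral `∫ r ^ s * exp (-b * r ^ l)` over `(0, ∞)` as a lower integral. -/
theorem lintegral_rpow_mul_exp_neg_mul_rpow {l s b : ℝ} (hl : 0 < l) (hs : -1 < s) (hb : 0 < b) :
    ∫⁻ r in Ioi (0 : ℝ), ENNReal.ofReal (r ^ s * Real.exp (-b * r ^ l)) =
      ENNReal.ofReal (b ^ (-(s + 1) / l) * (1 / l) * Real.Gamma ((s + 1) / l)) := by
  rw [← integral_rpow_mul_exp_neg_mul_rpow hl hs hb, ofReal_integral_eq_lintegral_ofReal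
    (integrableOn_rpow_mul_exp_neg_mul_rpow hs hl hb)]
  filter_upwards [ae_restrict_mem measurableSet_Ioi] with r hr
  have : (0 : ℝ) < r := hr
  positivity

/-- The Laplace representation `c⁻¹ = ∫ exp (-c * t)` over `(0, ∞)` as a lower integral. -/
theorem lintegral_exp_neg_mul_Ioi {c : ℝ} (hc : 0 < c) :
    ∫⁻ t in Ioi (0 : ℝ), ENNReal.ofReal (Real.exp (-c * t)) = ENNReal.ofReal c⁻¹ := by
  have h := lintegral_rpow_mul_exp_neg_mul_rpow one_pos (s := 0) (by norm_num) hc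
  simpa [Real.rpow_neg_one] using h

/-- The Beta-type integral `∫ r ^ (σ - 1) / (c + r ^ l)` over `(0, ∞)` as a lower integral. -/
theorem lintegral_rpow_div_add_rpow {l σ c : ℝ} (hσ : 0 < σ) (hσl : σ < l) (hc : 0 < c) :
    ∫⁻ r in Ioi (0 : ℝ), ENNReal.ofReal (r ^ (σ - 1) / (c + r ^ l)) =
      ENNReal.ofReal (c ^ (σ / l - 1) * (Real.pi / (l * Real.sin (Real.pi * (σ / l))))) := by
  have hl : 0 < l := hσ.trans hσl
  have hσl1 : σ / l < 1 := (div_lt_one hl).2 hσl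
  calc
    _ = ∫⁻ r in Ioi (0 : ℝ), ∫⁻ t in Ioi (0 : ℝ),
          ENNReal.ofReal (r ^ (σ - 1) * Real.exp (-(c + r ^ l) * t)) := by
      refine setLIntegral_congr_fun measurableSet_Ioi fun r hr ↦ ?_
      have hr : (0 : ℝ) < r := hr
      have hpos : 0 < c + r ^ l := by positivity
      simp_rw [ENNReal.ofReal_mul (Real.rpow_nonneg hr.le (σ - 1))]
      rw [lintegral_const_mul _ (by fun_prop), lintegral_exp_neg_mul_Ioi hpos,
        ← ENNReal.ofReal_mul (by positivity), div_eq_mul_inv]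
    _ = ∫⁻ t in Ioi (0 : ℝ), ∫⁻ r in Ioi (0 : ℝ),
          ENNReal.ofReal (r ^ (σ - 1) * Real.exp (-(c + r ^ l) * t)) :=
      lintegral_lintegral_swap (by fun_prop)
    _ = ∫⁻ t in Ioi (0 : ℝ), ENNReal.ofReal (1 / l * Real.Gamma (σ / l)) *
          ENNReal.ofReal (t ^ (-(σ / l)) * Real.exp (-c * t ^ (1 : ℝ))) := by
      refine setLIntegral_congr_fun measurableSet_Ioi fun t ht ↦ ?_
      have ht : (0 : ℝ) < t := ht
      have hG : 0 < Real.Gamma (σ / l) := Real.Gamma_pos_of_pos (by positivity)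
      have hfac (r : ℝ) : ENNReal.ofReal (r ^ (σ - 1) * Real.exp (-(c + r ^ l) * t)) =
          ENNReal.ofReal (Real.exp (-c * t)) *
            ENNReal.ofReal (r ^ (σ - 1) * Real.exp (-t * r ^ l)) := by
        rw [← ENNReal.ofReal_mul (by positivity), mul_left_comm, ← Real.exp_add]
        ring_nf
      simp_rw [hfac]
      rw [lintegral_const_mul _ (by fun_prop),
        lintegral_rpow_mul_exp_neg_mul_rpow hl (by linarith) ht,
        ← ENNReal.ofReal_mul (by positivity), ← ENNReal.ofReal_mul (by positivity)]
      rw [sub_add_cancel, Real.rpow_one, neg_div]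
      ring_nf
    _ = _ := by
      have hG : 0 < Real.Gamma (σ / l) := Real.Gamma_pos_of_pos (by positivity)
      rw [lintegral_const_mul _ (by fun_prop),
        lintegral_rpow_mul_exp_neg_mul_rpow one_pos (by linarith) hc,
        ← ENNReal.ofReal_mul (by positivity)]
      congr 1
      have h := Real.Gamma_mul_Gamma_one_sub (σ / l)
      rw [← div_div, div_right_comm, ← h]
      have e₁ : -(-(σ / l) + 1) / 1 = σ / l - 1 := by ring
      have e₂ : (-(σ / l) + 1) / 1 = 1 - σ / l := by ring
      rw [e₁, e₂]
      ring

/-- The radial integral `∫ ‖y‖ ^ (σ - n) / (c + ‖y‖ ^ l)` over `ℝⁿ` as a lower integral. -/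
theorem lintegral_norm_rpow_div_add_norm_rpow {n : ℕ} (hn : 1 ≤ n) {l σ c : ℝ} (hσ : 0 < σ)
    (hσl : σ < l) (hc : 0 < c) :
    ∫⁻ y : EuclideanSpace ℝ (Fin n), ENNReal.ofReal (‖y‖ ^ (σ - n) / (c + ‖y‖ ^ l)) =
      ENNReal.ofReal (c ^ (σ / l - 1) * ((n * Real.pi / (l * Real.sin (Real.pi * (σ / l)))) *
          (Real.pi ^ ((n : ℝ) / 2) / Real.Gamma ((n : ℝ) / 2 + 1)))) := by
  have : Nonempty (Fin n) := ⟨⟨0, hn⟩⟩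
  have hl : 0 < l := hσ.trans hσl
  have hσl1 : σ / l < 1 := (div_lt_one hl).2 hσl
  have hsin : 0 < Real.sin (Real.pi * (σ / l)) :=
    Real.sin_pos_of_pos_of_lt_pi (by positivity)
      (mul_lt_of_lt_one_right Real.pi_pos hσl1)
  have hrad := lintegral_rpow_div_add_rpow hσ hσl hc
  have hnonneg : 0 ≤ᵐ[volume.restrict (Ioi (0 : ℝ))] fun r ↦ r ^ (σ - 1) / (c + r ^ l) := by
    filter_upwards [ae_restrict_mem measurableSet_Ioi] with r hr
    have : (0 : ℝ) < r := hr
    positivity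
  have hmeas : AEStronglyMeasurable (fun r : ℝ ↦ r ^ (σ - 1) / (c + r ^ l))
      (volume.restrict (Ioi 0)) :=
    Measurable.aestronglyMeasurable (by fun_prop)
  have hint : IntegrableOn (fun r : ℝ ↦ r ^ (σ - 1) / (c + r ^ l)) (Ioi 0) := by
    refine ⟨hmeas, ?_⟩
    rw [hasFiniteIntegral_iff_ofReal hnonneg, hrad]
    exact ENNReal.ofReal_lt_top
  have hval : ∫ r in Ioi (0 : ℝ), r ^ (σ - 1) / (c + r ^ l) =
      c ^ (σ / l - 1) * (Real.pi / (l * Real.sin (Real.pi * (σ / l)))) := by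
    rw [integral_eq_lintegral_of_nonneg_ae hnonneg hmeas, hrad,
      ENNReal.toReal_ofReal (by positivity)]
  have hpow : EqOn (fun r : ℝ ↦ r ^ (Module.finrank ℝ (EuclideanSpace ℝ (Fin n)) - 1) •
      (r ^ (σ - n) / (c + r ^ l))) (fun r ↦ r ^ (σ - 1) / (c + r ^ l)) (Ioi 0) := by
    intro r hr
    have hr : (0 : ℝ) < r := hr
    simp only [finrank_euclideanSpace_fin, smul_eq_mul]
    rw [← mul_div_assoc, ← Real.rpow_natCast, ← Real.rpow_add hr, Nat.cast_sub hn]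
    congr 2
    push_cast
    ring
  rw [← ofReal_integral_eq_lintegral_ofReal
    ((integrable_fun_norm_addHaar volume (f := fun r ↦ r ^ (σ - n) / (c + r ^ l))).2
      (hint.congr_fun hpow.symm measurableSet_Ioi)) (ae_of_all _ fun y ↦ by positivity),
    integral_fun_norm_addHaar volume (fun r ↦ r ^ (σ - n) / (c + r ^ l)),
    setIntegral_congr_fun measurableSet_Ioi hpow, hval]
  congr 1
  rw [Measure.real, EuclideanSpace.volume_ball]
  have hG : 0 < Real.Gamma ((n : ℝ) / 2 + 1) := Real.Gamma_pos_of_pos (by positivity)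
  simp only [finrank_euclideanSpace_fin, Fintype.card_fin, ENNReal.ofReal_one, one_pow, one_mul,
    smul_eq_mul, nsmul_eq_mul]
  rw [ENNReal.toReal_ofReal (by positivity), Real.sqrt_eq_rpow, ← Real.rpow_mul_natCast Real.pi_pos.le]
  ring_nf

/-- The `p`-th power of one Hölder factor of the Hardy–Hilbert kernel, integrated over both
variables. -/
theorem lintegral_lintegral_hardyHilbert_factor {n : ℕ} (hn : 1 ≤ n) {p q k m l : ℝ} (hp : 1 < p)
    (hk : 1 < k) (hpq : 1 / p + 1 / q = 1) (hkm : 1 / k + 1 / m = 1) (hl : 0 < l)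
    {f : EuclideanSpace ℝ (Fin n) → ℝ≥0∞} (hf : Measurable f) :
    ∫⁻ x, ∫⁻ y : EuclideanSpace ℝ (Fin n), (f x * ENNReal.ofReal (‖x‖ ^ ((1 - l / k) / q) *
        (‖y‖ ^ (l / m - n) / (‖x‖ ^ l + ‖y‖ ^ l)) ^ (1 / p))) ^ p =
      ENNReal.ofReal ((n * Real.pi / (l * Real.sin (Real.pi / m))) *
          (Real.pi ^ ((n : ℝ) / 2) / Real.Gamma ((n : ℝ) / 2 + 1))) *
        ∫⁻ x, ENNReal.ofReal (‖x‖ ^ (p * (1 - l / k) - 1)) * f x ^ p := by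
  have : Nonempty (Fin n) := ⟨⟨0, hn⟩⟩
  have hp0 : 0 < p := by linarith
  have hk0 : 0 < k := by linarith
  have hk1 : 1 / k < 1 := by rw [div_lt_one hk0]; exact hk
  have hk1' : 0 < 1 / k := by positivity
  have hm0 : 0 < m := one_div_pos.1 (by linarith)
  rw [← lintegral_const_mul _ (by fun_prop)]
  refine lintegral_congr_ae ?_
  filter_upwards [Measure.ae_ne volume (0 : EuclideanSpace ℝ (Fin n))] with x hx
  have hx : 0 < ‖x‖ := norm_pos_iff.2 hx
  have hpow (y : EuclideanSpace ℝ (Fin n)) : (f x * ENNReal.ofReal (‖x‖ ^ ((1 - l / k) / q) *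
        (‖y‖ ^ (l / m - n) / (‖x‖ ^ l + ‖y‖ ^ l)) ^ (1 / p))) ^ p =
      (f x ^ p * ENNReal.ofReal (‖x‖ ^ ((1 - l / k) / q * p))) *
        ENNReal.ofReal (‖y‖ ^ (l / m - n) / (‖x‖ ^ l + ‖y‖ ^ l)) := by
    rw [ENNReal.mul_rpow_of_nonneg _ _ hp0.le, mul_assoc,
      ENNReal.ofReal_rpow_of_nonneg (by positivity) hp0.le,
      Real.mul_rpow (by positivity) (by positivity), ← Real.rpow_mul hx.le,
      ← Real.rpow_mul (by positivity), one_div_mul_cancel hp0.ne', Real.rpow_one,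
      ENNReal.ofReal_mul (by positivity)]
  simp_rw [hpow]
  have hlm : l / m < l := by
    rw [div_eq_mul_one_div]
    exact mul_lt_of_lt_one_right hl (by linarith)
  rw [lintegral_const_mul _ (by fun_prop),
    lintegral_norm_rpow_div_add_norm_rpow hn (by positivity) hlm (by positivity)]
  have hlm' : l / m / l = 1 / m := by field_simp
  rw [hlm', mul_one_div, ENNReal.ofReal_mul (by positivity), ← Real.rpow_mul hx.le]
  have hqp : (1 - l / k) / q * p = (1 - l / k) * (p - 1) := by
    have : 1 / q = 1 - 1 / p := by linarith
    rw [div_eq_mul_one_div _ q, this]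
    field_simp
  have hexp : p * (1 - l / k) - 1 = (1 - l / k) / q * p + l * (1 / m - 1) := by
    have : 1 / m - 1 = -(1 / k) := by linarith
    rw [hqp, this]
    ring
  rw [hexp, Real.rpow_add hx,
    ENNReal.ofReal_mul (p := ‖x‖ ^ ((1 - l / k) / q * p)) (by positivity)]
  ring

/-- The product of the two Hölder weights is the weighted Hardy–Hilbert kernel. -/
theorem hardyHilbert_weight_mul_weight {a b p q k m l d : ℝ} (ha : 0 < a) (hb : 0 < b)
    (hpq : 1 / p + 1 / q = 1) :
    a ^ ((1 - l / k) / q) * (b ^ (l / m - d) / (a ^ l + b ^ l)) ^ (1 / p) *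
        (b ^ ((1 - l / m) / p) * (a ^ (l / k - d) / (b ^ l + a ^ l)) ^ (1 / q)) =
      (a ^ l + b ^ l)⁻¹ * (a ^ ((1 - d) / q) * b ^ ((1 - d) / p)) := by
  have hD : 0 < a ^ l + b ^ l := by positivity
  rw [add_comm (b ^ l), Real.div_rpow (by positivity) hD.le, Real.div_rpow (by positivity) hD.le,
    ← Real.rpow_mul ha.le, ← Real.rpow_mul hb.le]
  have e₁ : (1 - d) / q = (1 - l / k) / q + (l / k - d) * (1 / q) := by ring
  have e₂ : (1 - d) / p = (1 - l / m) / p + (l / m - d) * (1 / p) := by ring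
  have e₃ : (a ^ l + b ^ l)⁻¹ =
      ((a ^ l + b ^ l) ^ (1 / p))⁻¹ * ((a ^ l + b ^ l) ^ (1 / q))⁻¹ := by
    rw [← mul_inv, ← Real.rpow_add hD, hpq, Real.rpow_one]
  rw [e₁, e₂, e₃, Real.rpow_add ha, Real.rpow_add hb]
  ring

/-- Weighted Hardy–Hilbert type inequality on `ℝⁿ` with the Euclidean norm and
kernel `1/(|x|^λ + |y|^λ)`, for `p, k > 1`, `1/p + 1/q = 1/k + 1/m = 1`, `λ > 0`. -/
theorem stmt_15 (n : ℕ) (hn : 1 ≤ n) (p q k m l : ℝ) (hp : 1 < p) (hk : 1 < k)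
    (hpq : 1 / p + 1 / q = 1) (hkm : 1 / k + 1 / m = 1) (hl : 0 < l)
    (f g : EuclideanSpace ℝ (Fin n) → ℝ≥0∞) (hf : Measurable f) (hg : Measurable g)
    (hfp : 0 < ∫⁻ x, ENNReal.ofReal (‖x‖ ^ (p * (1 - l / k) - 1)) * f x ^ p)
    (hfp' : ∫⁻ x, ENNReal.ofReal (‖x‖ ^ (p * (1 - l / k) - 1)) * f x ^ p < ⊤)
    (hgq : 0 < ∫⁻ y, ENNReal.ofReal (‖y‖ ^ (q * (1 - l / m) - 1)) * g y ^ q)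
    (hgq' : ∫⁻ y, ENNReal.ofReal (‖y‖ ^ (q * (1 - l / m) - 1)) * g y ^ q < ⊤) :
    ∫⁻ y, ∫⁻ x,
        f x * g y / ENNReal.ofReal (‖x‖ ^ l + ‖y‖ ^ l) *
          ENNReal.ofReal (‖x‖ ^ ((1 - (n : ℝ)) / q) * ‖y‖ ^ ((1 - (n : ℝ)) / p)) ≤
      ENNReal.ofReal ((n * Real.pi / (l * Real.sin (Real.pi / m))) *
          (Real.pi ^ ((n : ℝ) / 2) / Real.Gamma ((n : ℝ) / 2 + 1))) *
        (∫⁻ x, ENNReal.ofReal (‖x‖ ^ (p * (1 - l / k) - 1)) * f x ^ p) ^ (1 / p) *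
        (∫⁻ y, ENNReal.ofReal (‖y‖ ^ (q * (1 - l / m) - 1)) * g y ^ q) ^ (1 / q) := by
  have : Nonempty (Fin n) := ⟨⟨0, hn⟩⟩
  have hp0 : 0 < p := by linarith
  have hk0 : 0 < k := by linarith
  have hp1 : 1 / p < 1 := by rw [div_lt_one hp0]; exact hp
  have hk1 : 1 / k < 1 := by rw [div_lt_one hk0]; exact hk
  have hq0 : 0 < q := one_div_pos.1 (by linarith)
  have hm0 : 0 < m := one_div_pos.1 (by linarith)
  have hq : 1 < q := by
    rw [← div_lt_one hq0]
    linarith [one_div_pos.2 hp0]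
  have hm : 1 < m := by
    rw [← div_lt_one hm0]
    linarith [one_div_pos.2 hk0]
  have hconj : p.HolderConjugate q := Real.holderConjugate_iff.2 ⟨hp, by simpa using hpq⟩
  have hsin : Real.sin (Real.pi / k) = Real.sin (Real.pi / m) := by
    rw [← Real.sin_pi_sub]
    congr 1
    have : 1 / m = 1 - 1 / k := by linarith
    rw [div_eq_mul_one_div _ m, this]
    ring
  let A : EuclideanSpace ℝ (Fin n) × EuclideanSpace ℝ (Fin n) → ℝ≥0∞ := fun z ↦
    f z.1 * ENNReal.ofReal (‖z.1‖ ^ ((1 - l / k) / q) *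
      (‖z.2‖ ^ (l / m - n) / (‖z.1‖ ^ l + ‖z.2‖ ^ l)) ^ (1 / p))
  let B : EuclideanSpace ℝ (Fin n) × EuclideanSpace ℝ (Fin n) → ℝ≥0∞ := fun z ↦
    g z.2 * ENNReal.ofReal (‖z.2‖ ^ ((1 - l / m) / p) *
      (‖z.1‖ ^ (l / k - n) / (‖z.2‖ ^ l + ‖z.1‖ ^ l)) ^ (1 / q))
  have hA : Measurable A := by fun_prop
  have hB : Measurable B := by fun_prop
  have hkernel : ∫⁻ y, ∫⁻ x,
        f x * g y / ENNReal.ofReal (‖x‖ ^ l + ‖y‖ ^ l) *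
          ENNReal.ofReal (‖x‖ ^ ((1 - (n : ℝ)) / q) * ‖y‖ ^ ((1 - (n : ℝ)) / p)) =
      ∫⁻ y, ∫⁻ x, (A * B) (x, y) := by
    refine lintegral_congr_ae ?_
    filter_upwards [Measure.ae_ne volume (0 : EuclideanSpace ℝ (Fin n))] with y hy
    refine lintegral_congr_ae ?_
    filter_upwards [Measure.ae_ne volume (0 : EuclideanSpace ℝ (Fin n))] with x hx
    have hx : 0 < ‖x‖ := norm_pos_iff.2 hx
    have hy : 0 < ‖y‖ := norm_pos_iff.2 hy
    simp only [A, B, Pi.mul_apply]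
    rw [mul_mul_mul_comm, ← ENNReal.ofReal_mul (by positivity),
      hardyHilbert_weight_mul_weight hx hy hpq,
      ENNReal.ofReal_mul (p := (‖x‖ ^ l + ‖y‖ ^ l)⁻¹) (by positivity),
      ENNReal.ofReal_inv_of_pos (by positivity), div_eq_mul_inv, mul_assoc]
  have hAp : ∫⁻ z, A z ^ p ∂(volume.prod volume) = _ :=
    (lintegral_prod _ (by fun_prop)).trans
      (lintegral_lintegral_hardyHilbert_factor hn hp hk hpq hkm hl hf)
  have hBq : ∫⁻ z, B z ^ q ∂(volume.prod volume) = _ :=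
    (lintegral_prod_symm _ (by fun_prop)).trans
      (lintegral_lintegral_hardyHilbert_factor hn hq hm (by linarith) (by linarith) hl hg)
  rw [hkernel, ← lintegral_prod_symm _ (by fun_prop)]
  refine (ENNReal.lintegral_mul_le_Lp_mul_Lq _ hconj hA.aemeasurable hB.aemeasurable).trans_eq ?_
  rw [hAp, hBq, hsin, ENNReal.mul_rpow_of_nonneg _ _ (by positivity),
    ENNReal.mul_rpow_of_nonneg _ _ (by positivity), mul_mul_mul_comm,
    ← ENNReal.rpow_add_of_nonneg _ _ (by positivity) (by positivity), hpq, ENNReal.rpow_one,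
    mul_assoc]
end
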